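/- Let H be an infinite-dimensional separable complex Hilbert space. Then there exists a pure state ω on B(H) that is not a vector state: for every unit vector φ ∈ H there is some A ∈ B(H) with ω(A) ≠ ⟨φ, Aφ⟩. -/

import Mathlib

open scoped ComplexOrder ComplexInnerProductSpace

variable {H : Type*} [NormedAddCommGroup H] [InnerProductSpace ℂ H] [CompleteSpace H]

/-- A state on the C*-algebra `B(H)`: a linear functional that is positive
(`ω(A*A) ≥ 0`) and normalised (`ω(𝟙) = 1`). -/
def IsState (ω : (H →L[ℂ] H) → ℂ) : Prop :=
  (∀ x y : H →L[ℂ] H, ω (x + y) = ω x + ω y) ∧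
  (∀ (c : ℂ) (x : H →L[ℂ] H), ω (c • x) = c * ω x) ∧
  (∀ x : H →L[ℂ] H, 0 ≤ ω (star x * x)) ∧
  ω 1 = 1

/-- A state is pure if any decomposition of it as a convex combination
`λω₁ + (1−λ)ω₂` of states with `λ ∈ (0,1)` forces `ω₁ = ω₂`. -/
def IsPureState (ω : (H →L[ℂ] H) → ℂ) : Prop :=
  IsState ω ∧
    ∀ ω₁ ω₂ : (H →L[ℂ] H) → ℂ, IsState ω₁ → IsState ω₂ →
      ∀ l : ℝ, l ∈ Set.Ioo (0 : ℝ) 1 →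
        (∀ A : H →L[ℂ] H, ω A = (l : ℂ) * ω₁ A + (1 - (l : ℂ)) * ω₂ A) → ω₁ = ω₂

section States

variable {H : Type*} [NormedAddCommGroup H] [InnerProductSpace ℂ H] [CompleteSpace H]

theorem IsState.apply_star_mul_self_le {ω : (H →L[ℂ] H) → ℂ} (hω : IsState ω)
    (A : H →L[ℂ] H) : (ω (star A * A)).re ≤ ‖A‖ ^ 2 := by
  obtain ⟨hadd, hsmul, hpos, hone⟩ := hω
  have hle : star A * A ≤ algebraMap ℝ (H →L[ℂ] H) (‖A‖ ^ 2) :=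
    CStarAlgebra.star_mul_le_algebraMap_norm_sq
  obtain ⟨B, hB⟩ := CStarAlgebra.nonneg_iff_eq_star_mul_self.mp (sub_nonneg.mpr hle)
  have hsum : star B * B + star A * A = ((‖A‖ ^ 2 : ℝ) : ℂ) • (1 : H →L[ℂ] H) := by
    rw [← hB, sub_add_cancel, Algebra.algebraMap_eq_smul_one]
    rfl
  have h := congrArg (fun T => (ω T).re) hsum
  simp only [hadd, hsmul, hone, mul_one, Complex.add_re, Complex.ofReal_re] at h
  linarith [(Complex.nonneg_iff.mp (hpos B)).1]

theorem IsState.norm_apply_le {ω : (H →L[ℂ] H) → ℂ} (hω : IsState ω)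
    (A : H →L[ℂ] H) : ‖ω A‖ ≤ 2 * (1 + ‖A‖ ^ 2) := by
  have hA := hω.apply_star_mul_self_le A
  obtain ⟨hadd, hsmul, hpos, hone⟩ := hω
  have hexpand (c : ℂ) :
      0 ≤ 1 + c * ω A + star c * ω (star A) + star c * c * ω (star A * A) := by
    have h := hpos (1 + c • A)
    have hmul : star (1 + c • A) * (1 + c • A) =
        1 + c • A + star c • star A + (star c * c) • (star A * A) := by
      simp only [star_add, star_one, star_smul, add_mul, mul_add, one_mul, mul_one,
        smul_mul_smul_comm]
      abel
    rwa [hmul, hadd, hadd, hadd, hsmul, hsmul, hsmul, hone] at h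
  have h₁ := Complex.nonneg_iff.mp (hexpand 1)
  have h₂ := Complex.nonneg_iff.mp (hexpand (-1))
  have h₃ := Complex.nonneg_iff.mp (hexpand Complex.I)
  have h₄ := Complex.nonneg_iff.mp (hexpand (-Complex.I))
  have h₅ := Complex.nonneg_iff.mp (hpos A)
  simp at h₁ h₂ h₃ h₄ h₅
  refine (Complex.norm_le_abs_re_add_abs_im _).trans ?_
  have hre : |(ω A).re| ≤ 1 + ‖A‖ ^ 2 := abs_le.mpr ⟨by linarith, by linarith⟩
  have him : |(ω A).im| ≤ 1 + ‖A‖ ^ 2 := abs_le.mpr ⟨by linarith, by linarith⟩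
  linarith

theorem isCompact_setOf_isState : IsCompact {ω : (H →L[ℂ] H) → ℂ | IsState ω} := by
  refine (isCompact_univ_pi fun A : H →L[ℂ] H =>
    isCompact_closedBall (0 : ℂ) (2 * (1 + ‖A‖ ^ 2))).of_isClosed_subset ?_ ?_
  · simp only [IsState, Set.ofPred_and, Set.ofPred_forall]
    refine .inter ?_ (.inter ?_ (.inter ?_ ?_))
    · exact isClosed_iInter fun x => isClosed_iInter fun y =>
        isClosed_eq (by fun_prop) (by fun_prop)
    · exact isClosed_iInter fun c => isClosed_iInter fun x =>
        isClosed_eq (by fun_prop) (by fun_prop)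
    · exact isClosed_iInter fun x => isClosed_le (by fun_prop) (by fun_prop)
    · exact isClosed_eq (by fun_prop) (by fun_prop)
  · intro ω hω A _
    simpa using hω.norm_apply_le A

theorem inner_star_mul_self_apply (A : H →L[ℂ] H) (φ : H) :
    ⟪φ, (star A * A) φ⟫ = ((‖A φ‖ ^ 2 : ℝ) : ℂ) := by
  rw [ContinuousLinearMap.star_eq_adjoint, mul_apply_eq_comp,
    ContinuousLinearMap.adjoint_inner_right, inner_self_eq_norm_sq_to_K]
  norm_cast

theorem isState_inner {φ : H} (hφ : ‖φ‖ = 1) :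
    IsState fun A : H →L[ℂ] H => ⟪φ, A φ⟫ := by
  refine ⟨fun x y => by simp, fun c x => by simp,
    fun x => ?_, by simp [inner_self_eq_norm_sq_to_K, hφ]⟩
  simp only [inner_star_mul_self_apply]
  exact_mod_cast sq_nonneg ‖x φ‖

/-- The states that vanish on `A* A` for every operator `A` of the form `y ↦ ⟪x, y⟫ x`. -/
def singularStates (H : Type*) [NormedAddCommGroup H] [InnerProductSpace ℂ H]
    [CompleteSpace H] : Set ((H →L[ℂ] H) → ℂ) :=
  {ω | IsState ω ∧ ∀ x : H, ω (star (InnerProductSpace.rankOne ℂ x x) *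
    InnerProductSpace.rankOne ℂ x x) = 0}

theorem isCompact_singularStates : IsCompact (singularStates H) := by
  have hset : singularStates H = {ω | IsState ω} ∩ ⋂ x : H,
      {ω | ω (star (InnerProductSpace.rankOne ℂ x x) *
        InnerProductSpace.rankOne ℂ x x) = 0} := by
    ext ω
    simp only [singularStates, Set.mem_ofPred_eq, Set.mem_inter_iff, Set.mem_iInter]
  rw [hset]
  exact isCompact_setOf_isState.inter_right <| isClosed_iInter fun x =>
    isClosed_eq (by fun_prop) (by fun_prop)

theorem singularStates_nonempty (hinf : ¬ FiniteDimensional ℂ H) :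
    (singularStates H).Nonempty := by
  obtain ⟨w, b, -⟩ := exists_hilbertBasis ℂ H
  have hw : Infinite w := by
    by_contra hfin
    rw [not_infinite_iff_finite] at hfin
    refine hinf ?_
    have hfd : FiniteDimensional ℂ (Submodule.span ℂ (Set.range b)) :=
      FiniteDimensional.span_of_finite ℂ (Set.finite_range b)
    have htop := b.dense_span
    rw [(Submodule.closed_of_finiteDimensional _).submodule_topologicalClosure_eq] at htop
    rw [htop] at hfd
    exact Module.finite_def.mpr (Module.Finite.iff_fg.mp hfd)
  let F : w → (H →L[ℂ] H) → ℂ := fun i A => ⟪b i, A (b i)⟫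
  obtain ⟨ω, hω, hlim⟩ := isCompact_setOf_isState.ultrafilter_le_nhds
    ((Filter.hyperfilter w).map F) (Filter.le_principal_iff.mpr
      (Filter.mem_map.mpr <| Filter.univ_mem' fun i => isState_inner (b.orthonormal.1 i)))
  refine ⟨ω, hω, fun x => ?_⟩
  have hlim' : Filter.Tendsto F (Filter.hyperfilter w) (nhds ω) := hlim
  refine tendsto_nhds_unique (tendsto_pi_nhds.mp hlim' _) ?_
  have hinner : Filter.Tendsto (fun i => ‖⟪b i, x⟫‖ ^ 2) Filter.cofinite (nhds 0) :=
    (b.orthonormal.inner_products_summable x).tendsto_cofinite_zero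
  have hscaled : Filter.Tendsto (fun i => ((‖⟪b i, x⟫‖ ^ 2 * ‖x‖ ^ 2 : ℝ) : ℂ))
      Filter.cofinite (nhds 0) := by
    have hreal : Filter.Tendsto (fun i => ‖⟪b i, x⟫‖ ^ 2 * ‖x‖ ^ 2)
        Filter.cofinite (nhds 0) := by
      simpa only [zero_mul] using hinner.mul_const (‖x‖ ^ 2)
    rw [← Complex.ofReal_zero]
    exact (Complex.continuous_ofReal.tendsto 0).comp hreal
  refine (hscaled.mono_left Filter.hyperfilter_le_cofinite).congr fun i => ?_
  simp only [F]
  rw [inner_star_mul_self_apply, InnerProductSpace.rankOne_apply, norm_smul, mul_pow,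
    norm_inner_symm]

theorem IsState.eq_zero_of_convexCombination {ω₁ ω₂ : (H →L[ℂ] H) → ℂ}
    (h₁ : IsState ω₁) (h₂ : IsState ω₂) {l : ℝ} (hl : l ∈ Set.Ioo (0 : ℝ) 1)
    {A : H →L[ℂ] H}
    (h : (l : ℂ) * ω₁ (star A * A) + (1 - (l : ℂ)) * ω₂ (star A * A) = 0) :
    ω₁ (star A * A) = 0 ∧ ω₂ (star A * A) = 0 := by
  have hl₁ : (0 : ℂ) < l := by exact_mod_cast hl.1
  have hl₂ : (0 : ℂ) < 1 - (l : ℂ) := by exact_mod_cast sub_pos.mpr hl.2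
  rw [add_eq_zero_iff_of_nonneg (mul_nonneg hl₁.le (h₁.2.2.1 A))
    (mul_nonneg hl₂.le (h₂.2.2.1 A))] at h
  exact ⟨(mul_eq_zero.mp h.1).resolve_left hl₁.ne', (mul_eq_zero.mp h.2).resolve_left hl₂.ne'⟩

theorem isPureState_of_mem_extremePoints {ω : (H →L[ℂ] H) → ℂ}
    (hω : ω ∈ (singularStates H).extremePoints ℝ) : IsPureState ω := by
  refine ⟨hω.1.1, fun ω₁ ω₂ h₁ h₂ l hl h => ?_⟩
  have hzero (x : H) := h₁.eq_zero_of_convexCombination h₂ hl ((h _).symm.trans (hω.1.2 x))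
  have hseg : ω ∈ openSegment ℝ ω₁ ω₂ := by
    refine ⟨l, 1 - l, hl.1, sub_pos.mpr hl.2, by ring, ?_⟩
    ext A
    simp [h A]
  obtain ⟨e₁, e₂⟩ := (mem_extremePoints.mp hω).2 ω₁ ⟨h₁, fun x => (hzero x).1⟩ ω₂
    ⟨h₂, fun x => (hzero x).2⟩ hseg
  exact e₁.trans e₂.symm

end States

/-- On an infinite-dimensional separable complex Hilbert space there exists a
pure state on `B(H)` that is not a vector state: for every unit vector `φ`
there is some bounded operator `A` with `ω(A) ≠ ⟨φ, Aφ⟩`. -/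
theorem exists_pure_state_not_vector_state [TopologicalSpace.SeparableSpace H]
    (hinf : ¬ FiniteDimensional ℂ H) :
    ∃ ω : (H →L[ℂ] H) → ℂ, IsPureState ω ∧
      ∀ φ : H, ‖φ‖ = 1 → ∃ A : H →L[ℂ] H, ω A ≠ ⟪φ, A φ⟫ := by
  obtain ⟨ω, hω⟩ := isCompact_singularStates.extremePoints_nonempty (singularStates_nonempty hinf)
  refine ⟨ω, isPureState_of_mem_extremePoints hω, fun φ hφ =>
    ⟨star (InnerProductSpace.rankOne ℂ φ φ) * InnerProductSpace.rankOne ℂ φ φ, ?_⟩⟩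
  rw [hω.1.2 φ, inner_star_mul_self_apply, InnerProductSpace.rankOne_apply, norm_smul]
  simp [inner_self_eq_norm_sq_to_K, hφ]
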